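/- (Theorem 1, relations rt-4 and rt-5 for the symmetrized generators.) The elements A_i(k) = (1/2)(a_i(k)+α_i(k)) satisfy, for all k₁,k₂ ∈ ℝ and indices i,j,l: A_i(k₁)t_{jl}(k₂) = Σ_{q,r,s,m} [S₂₁(k₂,k₁)]^{(i,j)}_{(r,q)} t_{qs}(k₂)[S₁₂(k₁,k₂)]^{(r,s)}_{(m,l)} A_m(k₁), and A_i(k₁)r_{jl}(k₂) = Σ_{q,r,s,m} [S₂₁(k₂,k₁)]^{(i,j)}_{(r,q)} r_{qs}(k₂)[S₁₂(k₁,−k₂)]^{(r,s)}_{(m,l)} A_m(k₁). -/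

import Mathlib

open scoped Matrix BigOperators

variable {n : ℕ}

/-- `[S₂₁(k₂,k₁)]^{(i,j)}_{(p,q)} = [S(k₂,k₁)]^{(j,i)}_{(q,p)}`. -/
def S21 (S : ℝ → ℝ → Matrix (Fin n × Fin n) (Fin n × Fin n) ℂ) (k₂ k₁ : ℝ) :
    Matrix (Fin n × Fin n) (Fin n × Fin n) ℂ :=
  Matrix.of fun x y => S k₂ k₁ (x.2, x.1) (y.2, y.1)

/-- `M₁ = M ⊗ Iₙ`. -/
def leg1 {A : Type*} [Semiring A] [DecidableEq (Fin n)]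
    (M : Matrix (Fin n) (Fin n) A) :
    Matrix (Fin n × Fin n) (Fin n × Fin n) A :=
  Matrix.of fun x y => if x.2 = y.2 then M x.1 y.1 else 0

/-- `M₂ = Iₙ ⊗ M`. -/
def leg2 {A : Type*} [Semiring A] [DecidableEq (Fin n)]
    (M : Matrix (Fin n) (Fin n) A) :
    Matrix (Fin n × Fin n) (Fin n × Fin n) A :=
  Matrix.of fun x y => if x.1 = y.1 then M x.2 y.2 else 0

/-- entrywise embedding of a scalar `n² × n²` matrix into matrices over `𝒜`. -/
def emb (𝒜 : Type*) [Ring 𝒜] [Algebra ℂ 𝒜]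
    (M : Matrix (Fin n × Fin n) (Fin n × Fin n) ℂ) :
    Matrix (Fin n × Fin n) (Fin n × Fin n) 𝒜 :=
  M.map (algebraMap ℂ 𝒜)

/-- entrywise embedding of a scalar `n × n` matrix into matrices over `𝒜`. -/
def embn (𝒜 : Type*) [Ring 𝒜] [Algebra ℂ 𝒜] (M : Matrix (Fin n) (Fin n) ℂ) :
    Matrix (Fin n) (Fin n) 𝒜 :=
  M.map (algebraMap ℂ 𝒜)

/-- `W₁₂` acting on factors 1,2 of `(ℂⁿ)^{⊗3}`. -/
def leg12 (W : Matrix (Fin n × Fin n) (Fin n × Fin n) ℂ) :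
    Matrix (Fin n × Fin n × Fin n) (Fin n × Fin n × Fin n) ℂ :=
  Matrix.of fun x y => if x.2.2 = y.2.2 then W (x.1, x.2.1) (y.1, y.2.1) else 0

/-- `W₁₃` acting on factors 1,3 of `(ℂⁿ)^{⊗3}`. -/
def leg13 (W : Matrix (Fin n × Fin n) (Fin n × Fin n) ℂ) :
    Matrix (Fin n × Fin n × Fin n) (Fin n × Fin n × Fin n) ℂ :=
  Matrix.of fun x y => if x.2.1 = y.2.1 then W (x.1, x.2.2) (y.1, y.2.2) else 0

/-- `W₂₃` acting on factors 2,3 of `(ℂⁿ)^{⊗3}`. -/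
def leg23 (W : Matrix (Fin n × Fin n) (Fin n × Fin n) ℂ) :
    Matrix (Fin n × Fin n × Fin n) (Fin n × Fin n × Fin n) ℂ :=
  Matrix.of fun x y => if x.1 = y.1 then W (x.2.1, x.2.2) (y.2.1, y.2.2) else 0

/-- The vector `c` in the first tensor factor, `c ⊗ Iₙ`, as an `n² × n` matrix. -/
def colLeg1 {A : Type*} [Semiring A] (c : Fin n → A) : Matrix (Fin n × Fin n) (Fin n) A :=
  Matrix.of fun x l => if x.2 = l then c x.1 else 0

section Legs

variable {𝒜 : Type*} [Ring 𝒜]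

theorem leg1_mul_apply {m : Type*} (T : Matrix (Fin n) (Fin n) 𝒜)
    (M : Matrix (Fin n × Fin n) m 𝒜) (i j : Fin n) (l : m) :
    (leg1 T * M) (i, j) l = ∑ p, T i p * M (p, j) l := by
  simp [leg1, Matrix.mul_apply, Fintype.sum_prod_type, ite_mul]

theorem leg2_mul_apply {m : Type*} (T : Matrix (Fin n) (Fin n) 𝒜)
    (M : Matrix (Fin n × Fin n) m 𝒜) (i j : Fin n) (l : m) :
    (leg2 T * M) (i, j) l = ∑ p, T j p * M (i, p) l := by
  simp only [leg2, Matrix.mul_apply, Fintype.sum_prod_type_right, Matrix.of_apply, ite_mul,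
    zero_mul, Finset.sum_ite_eq, Finset.mem_univ, if_true]

theorem colLeg1_mul_apply (c : Fin n → 𝒜) (T : Matrix (Fin n) (Fin n) 𝒜) (i j l : Fin n) :
    (colLeg1 c * T) (i, j) l = c i * T j l := by
  simp [colLeg1, Matrix.mul_apply, ite_mul]

theorem colLeg1_add (c d : Fin n → 𝒜) : colLeg1 (c + d) = colLeg1 c + colLeg1 d := by
  ext ⟨i, j⟩ l
  by_cases h : j = l <;> simp [colLeg1, h]

theorem colLeg1_mulVec (T : Matrix (Fin n) (Fin n) 𝒜) (c : Fin n → 𝒜) :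
    colLeg1 (T *ᵥ c) = leg1 T * colLeg1 c := by
  ext ⟨i, j⟩ l
  rw [leg1_mul_apply]
  by_cases h : j = l <;> simp [colLeg1, h, Matrix.mulVec, dotProduct]

theorem submatrix_swap_leg1 (T : Matrix (Fin n) (Fin n) 𝒜) :
    (leg1 T).submatrix (Equiv.prodComm _ _) (Equiv.prodComm _ _) = leg2 T := rfl

theorem submatrix_swap_leg2 (T : Matrix (Fin n) (Fin n) 𝒜) :
    (leg2 T).submatrix (Equiv.prodComm _ _) (Equiv.prodComm _ _) = leg1 T := rfl

variable [Algebra ℂ 𝒜]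

theorem emb_mul (M N : Matrix (Fin n × Fin n) (Fin n × Fin n) ℂ) :
    emb 𝒜 (M * N) = emb 𝒜 M * emb 𝒜 N :=
  Matrix.map_mul

theorem emb_one : emb 𝒜 (1 : Matrix (Fin n × Fin n) (Fin n × Fin n) ℂ) = 1 :=
  Matrix.map_one _ (map_zero _) (map_one _)

theorem emb_mul_apply {m : Type*} (X : Matrix (Fin n × Fin n) (Fin n × Fin n) ℂ)
    (M : Matrix (Fin n × Fin n) m 𝒜) (x : Fin n × Fin n) (l : m) :
    (emb 𝒜 X * M) x l = ∑ q, ∑ p, X x (p, q) • M (p, q) l := by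
  simp only [emb, Matrix.mul_apply, Fintype.sum_prod_type_right, Matrix.map_apply,
    Algebra.smul_def]

theorem emb_mul_colLeg1_apply (Y : Matrix (Fin n × Fin n) (Fin n × Fin n) ℂ)
    (c : Fin n → 𝒜) (x : Fin n × Fin n) (l : Fin n) :
    (emb 𝒜 Y * colLeg1 c) x l = ∑ m, Y x (m, l) • c m := by
  rw [emb_mul_apply, Finset.sum_comm]
  simp [colLeg1]

theorem colLeg1_smul (z : ℂ) (c : Fin n → 𝒜) : colLeg1 (z • c) = z • colLeg1 c := by
  ext ⟨i, j⟩ l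
  by_cases h : j = l <;> simp [colLeg1, h]

/-- The componentwise exchange relation between a vector and a matrix is the identity
`c₁ T₂ = X T₂ Y c₁`. -/
theorem exchange_iff (X Y : Matrix (Fin n × Fin n) (Fin n × Fin n) ℂ)
    (T : Matrix (Fin n) (Fin n) 𝒜) (c : Fin n → 𝒜) :
    (∀ i j l : Fin n, c i * T j l =
      ∑ q, ∑ p, ∑ s, ∑ m, (X (i, j) (p, q) * Y (p, s) (m, l)) • (T q s * c m)) ↔
    colLeg1 c * T = emb 𝒜 X * (leg2 T * (emb 𝒜 Y * colLeg1 c)) := by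
  have key : ∀ i j l : Fin n, (emb 𝒜 X * (leg2 T * (emb 𝒜 Y * colLeg1 c))) (i, j) l =
      ∑ q, ∑ p, ∑ s, ∑ m, (X (i, j) (p, q) * Y (p, s) (m, l)) • (T q s * c m) := by
    intro i j l
    simp only [emb_mul_apply X, leg2_mul_apply, emb_mul_colLeg1_apply, Finset.mul_sum,
      Finset.smul_sum, mul_smul, mul_smul_comm]
  constructor
  · intro h
    ext ⟨i, j⟩ l
    rw [colLeg1_mul_apply, key, h]
  · intro h i j l
    rw [← colLeg1_mul_apply, h, key]

theorem submatrix_swap_emb (S : ℝ → ℝ → Matrix (Fin n × Fin n) (Fin n × Fin n) ℂ) (k k' : ℝ) :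
    (emb 𝒜 (S k k')).submatrix (Equiv.prodComm _ _) (Equiv.prodComm _ _) =
      emb 𝒜 (S21 S k k') := rfl

theorem S21_S21 (S : ℝ → ℝ → Matrix (Fin n × Fin n) (Fin n × Fin n) ℂ) : S21 (S21 S) = S := rfl

/-- Exchanging the two tensor factors in a relation between `t` and `r`. -/
theorem swap_reflection_relation (S : ℝ → ℝ → Matrix (Fin n × Fin n) (Fin n × Fin n) ℂ)
    {T R : Matrix (Fin n) (Fin n) 𝒜} {k₁ k₂ : ℝ}
    (h : emb 𝒜 (S k₁ k₂) * leg1 T * emb 𝒜 (S21 S k₂ k₁) * leg2 R =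
      leg2 R * emb 𝒜 (S k₁ (-k₂)) * leg1 T * emb 𝒜 (S21 S (-k₂) k₁)) :
    emb 𝒜 (S21 S k₁ k₂) * leg2 T * emb 𝒜 (S k₂ k₁) * leg1 R =
      leg1 R * emb 𝒜 (S21 S k₁ (-k₂)) * leg2 T * emb 𝒜 (S (-k₂) k₁) := by
  have h' := congrArg (fun M => M.submatrix (Equiv.prodComm (Fin n) (Fin n))
    (Equiv.prodComm (Fin n) (Fin n))) h
  simpa only [← Matrix.submatrix_mul_equiv _ _ _ (Equiv.prodComm (Fin n) (Fin n)) _,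
    submatrix_swap_leg1, submatrix_swap_leg2, submatrix_swap_emb, S21_S21] using h'

/-- If `c` and `c'` satisfy exchange relations with `T` and the matrices `t`, `r` intertwine them,
then every multiple of `c + t c + r c'` satisfies the same exchange relation as `c`. -/
theorem exchange_symmetrized {X Y X' Y' : Matrix (Fin n × Fin n) (Fin n × Fin n) ℂ}
    {T t r : Matrix (Fin n) (Fin n) 𝒜} {c c' : Fin n → 𝒜}
    (hc : colLeg1 c * T = emb 𝒜 X * (leg2 T * (emb 𝒜 Y * colLeg1 c)))
    (hc' : colLeg1 c' * T = emb 𝒜 X' * (leg2 T * (emb 𝒜 Y' * colLeg1 c')))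
    (ht : leg1 t * emb 𝒜 X * leg2 T * emb 𝒜 Y = emb 𝒜 X * leg2 T * emb 𝒜 Y * leg1 t)
    (hr : leg1 r * emb 𝒜 X' * leg2 T * emb 𝒜 Y' = emb 𝒜 X * leg2 T * emb 𝒜 Y * leg1 r)
    (z : ℂ) :
    colLeg1 (z • (c + (t *ᵥ c + r *ᵥ c'))) * T =
      emb 𝒜 X * (leg2 T * (emb 𝒜 Y * colLeg1 (z • (c + (t *ᵥ c + r *ᵥ c'))))) := by
  simp only [← Matrix.mul_assoc] at hc hc' ⊢
  simp only [colLeg1_smul, colLeg1_add, colLeg1_mulVec, Matrix.smul_mul, Matrix.mul_smul,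
    Matrix.add_mul, Matrix.mul_add, ← Matrix.mul_assoc, ← ht, ← hr]
  simp only [Matrix.mul_assoc] at hc hc' ⊢
  rw [hc, hc']

end Legs

theorem stmt_14
    (hn : 1 ≤ n)
    (S : ℝ → ℝ → Matrix (Fin n × Fin n) (Fin n × Fin n) ℂ)
    (hU : ∀ k₁ k₂, S k₁ k₂ * S21 S k₂ k₁ = 1)
    (hYB : ∀ k₁ k₂ k₃,
      leg12 (S k₁ k₂) * leg13 (S k₁ k₃) * leg23 (S k₂ k₃) =
        leg23 (S k₂ k₃) * leg13 (S k₁ k₃) * leg12 (S k₁ k₂))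
    (𝒜 : Type*) [Ring 𝒜] [Algebra ℂ 𝒜]
    (a ad : ℝ → Fin n → 𝒜)
    (t r : ℝ → Matrix (Fin n) (Fin n) 𝒜)
    (hZF1 : ∀ k₁ k₂ (i j : Fin n), a k₁ i * a k₂ j =
      ∑ p, ∑ q, S21 S k₂ k₁ (i, j) (p, q) • (a k₂ q * a k₁ p))
    (hZF2 : ∀ k₁ k₂ (i j : Fin n), ad k₁ i * ad k₂ j =
      ∑ p, ∑ q, S21 S k₂ k₁ (p, q) (i, j) • (ad k₂ q * ad k₁ p))
    (hE1 : ∀ k₁ k₂ (i j l : Fin n), a k₁ i * t k₂ j l =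
      ∑ q, ∑ r', ∑ s, ∑ m,
        (S21 S k₂ k₁ (i, j) (r', q) * S k₁ k₂ (r', s) (m, l)) • (t k₂ q s * a k₁ m))
    (hE2 : ∀ k₁ k₂ (i j l : Fin n), a k₁ i * r k₂ j l =
      ∑ q, ∑ r', ∑ s, ∑ m,
        (S21 S k₂ k₁ (i, j) (r', q) * S k₁ (-k₂) (r', s) (m, l)) • (r k₂ q s * a k₁ m))
    (hE3 : ∀ k₁ k₂ (i l j : Fin n), t k₁ i l * ad k₂ j =
      ∑ p, ∑ q, ∑ r', ∑ s,
        (S k₁ k₂ (i, p) (q, r') * S21 S k₂ k₁ (s, r') (l, j)) • (ad k₂ p * t k₁ q s))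
    (hE4 : ∀ k₁ k₂ (i l j : Fin n), r k₁ i l * ad k₂ j =
      ∑ p, ∑ q, ∑ r', ∑ s,
        (S k₁ k₂ (i, p) (q, r') * S21 S k₂ (-k₁) (s, r') (l, j)) • (ad k₂ p * r k₁ q s))
    (hE5 : ∀ k₁ k₂,
      emb 𝒜 (S k₁ k₂) * leg1 (t k₁) * emb 𝒜 (S21 S k₂ k₁) * leg2 (t k₂) =
        leg2 (t k₂) * emb 𝒜 (S k₁ k₂) * leg1 (t k₁) * emb 𝒜 (S21 S k₂ k₁))
    (hE6 : ∀ k₁ k₂,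
      emb 𝒜 (S k₁ k₂) * leg1 (t k₁) * emb 𝒜 (S21 S k₂ k₁) * leg2 (r k₂) =
        leg2 (r k₂) * emb 𝒜 (S k₁ (-k₂)) * leg1 (t k₁) * emb 𝒜 (S21 S (-k₂) k₁))
    (hE7 : ∀ k₁ k₂,
      emb 𝒜 (S k₁ k₂) * leg1 (r k₁) * emb 𝒜 (S21 S k₂ (-k₁)) * leg2 (r k₂) =
        leg2 (r k₂) * emb 𝒜 (S k₁ (-k₂)) * leg1 (r k₁) * emb 𝒜 (S21 S (-k₂) (-k₁)))
    (hE8 : ∀ k, t k * t k + r k * r (-k) = 1)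
    (hE9 : ∀ k, t k * r k + r k * t (-k) = 0)
    (al ald A Ad : ℝ → Fin n → 𝒜)
    (hal : ∀ k (i : Fin n), al k i = ∑ j, (t k i j * a k j + r k i j * a (-k) j))
    (hald : ∀ k (i : Fin n), ald k i = ∑ j, (ad k j * t k j i + ad (-k) j * r (-k) j i))
    (hA : ∀ k (i : Fin n), A k i = (2 : ℂ)⁻¹ • (a k i + al k i))
    (hAd : ∀ k (i : Fin n), Ad k i = (2 : ℂ)⁻¹ • (ad k i + ald k i))
    :
    ∀ k₁ k₂ (i j l : Fin n),
      (A k₁ i * t k₂ j l =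
        ∑ q, ∑ r', ∑ s, ∑ m,
          (S21 S k₂ k₁ (i, j) (r', q) * S k₁ k₂ (r', s) (m, l)) • (t k₂ q s * A k₁ m)) ∧
      (A k₁ i * r k₂ j l =
        ∑ q, ∑ r', ∑ s, ∑ m,
          (S21 S k₂ k₁ (i, j) (r', q) * S k₁ (-k₂) (r', s) (m, l)) • (r k₂ q s * A k₁ m)) := by
  have hV : ∀ k₁ k₂, emb 𝒜 (S k₁ k₂) * emb 𝒜 (S21 S k₂ k₁) = 1 := fun k₁ k₂ => by
    rw [← emb_mul, hU, emb_one]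
  have hV' : ∀ k₁ k₂, emb 𝒜 (S21 S k₂ k₁) * emb 𝒜 (S k₁ k₂) = 1 := fun k₁ k₂ => by
    rw [← emb_mul, mul_eq_one_comm.mp (hU k₁ k₂), emb_one]
  have cancel : ∀ (k₁ k₂ k₃ k₄ : ℝ) (M N : Matrix (Fin n × Fin n) (Fin n × Fin n) 𝒜),
      emb 𝒜 (S k₁ k₂) * M = N * emb 𝒜 (S21 S k₄ k₃) →
        M * emb 𝒜 (S k₃ k₄) = emb 𝒜 (S21 S k₂ k₁) * N := by
    intro k₁ k₂ k₃ k₄ M N h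
    calc M * emb 𝒜 (S k₃ k₄)
        = emb 𝒜 (S21 S k₂ k₁) * (emb 𝒜 (S k₁ k₂) * M) * emb 𝒜 (S k₃ k₄) := by
          rw [← mul_assoc (emb 𝒜 (S21 S k₂ k₁)), hV', one_mul]
      _ = emb 𝒜 (S21 S k₂ k₁) * N := by rw [h, mul_assoc, mul_assoc, hV', mul_one]
  have hAk : ∀ k, A k = (2 : ℂ)⁻¹ • (a k + (t k *ᵥ a k + r k *ᵥ a (-k))) := by
    intro k
    ext i
    simp [hA, hal, Matrix.mulVec, dotProduct, Finset.sum_add_distrib]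
  intro k₁ k₂
  have ht := (exchange_iff _ _ (t k₂) (A k₁)).mpr (by
    rw [hAk]
    refine exchange_symmetrized ((exchange_iff _ _ _ _).mp (hE1 k₁ k₂))
      ((exchange_iff _ _ _ _).mp (hE1 (-k₁) k₂)) ?_ ?_ _
    · simpa only [mul_assoc] using cancel k₁ k₂ k₁ k₂
        (leg1 (t k₁) * emb 𝒜 (S21 S k₂ k₁) * leg2 (t k₂))
        (leg2 (t k₂) * emb 𝒜 (S k₁ k₂) * leg1 (t k₁))
        (by simpa only [mul_assoc] using hE5 k₁ k₂)
    · exact (swap_reflection_relation S (hE6 k₂ k₁)).symm)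
  have hr := (exchange_iff _ _ (r k₂) (A k₁)).mpr (by
    rw [hAk]
    refine exchange_symmetrized ((exchange_iff _ _ _ _).mp (hE2 k₁ k₂))
      ((exchange_iff _ _ _ _).mp (hE2 (-k₁) k₂)) ?_ ?_ _
    · simpa only [mul_assoc] using cancel k₁ k₂ k₁ (-k₂)
        (leg1 (t k₁) * emb 𝒜 (S21 S k₂ k₁) * leg2 (r k₂))
        (leg2 (r k₂) * emb 𝒜 (S k₁ (-k₂)) * leg1 (t k₁))
        (by simpa only [mul_assoc] using hE6 k₁ k₂)
    · simpa only [mul_assoc] using cancel k₁ k₂ (-k₁) (-k₂)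
        (leg1 (r k₁) * emb 𝒜 (S21 S k₂ (-k₁)) * leg2 (r k₂))
        (leg2 (r k₂) * emb 𝒜 (S k₁ (-k₂)) * leg1 (r k₁))
        (by simpa only [mul_assoc] using hE7 k₁ k₂))
  exact fun i j l => ⟨ht i j l, hr i j l⟩
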